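/- Let E be a finite set and let f : Finset E → ℤ be a monotone and submodular function. Let K ⊆ E be a subset with f(K) = f(E) and |K| = k ≥ 1, and let C ⊆ E. Suppose e* ∈ E maximizes the marginal gain, i.e., f(C ∪ {e*}) − f(C) ≥ f(C ∪ {e}) − f(C) for all e ∈ E. Then k · (f(E) − f(C ∪ {e*})) ≤ (k − 1) · (f(E) − f(C)); that is, adding e* decreases the deficiency f(E) − f(C) by a factor of at least 1 − 1/k. -/

import Mathlib

/-- A function `f` on subsets of a finite set is submodular if for all
`B ⊆ A` and every `e ∉ A`, `f (B + e) - f B ≥ f (A + e) - f A`. -/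
def Submodular {E : Type*} [DecidableEq E] (f : Finset E → ℤ) : Prop :=
  ∀ ⦃B A : Finset E⦄, B ⊆ A → ∀ e ∉ A,
    f (insert e A) - f A ≤ f (insert e B) - f B

/-- For a monotone submodular function, the gain of adjoining a set is at most the sum of the
marginal gains of its elements. -/
theorem Submodular.union_sub_le_sum {E : Type*} [DecidableEq E] {f : Finset E → ℤ}
    (hsub : Submodular f) (hmono : Monotone f) (C K : Finset E) :
    f (C ∪ K) - f C ≤ ∑ e ∈ K, (f (insert e C) - f C) := by
  induction K using Finset.induction_on with
  | empty => simp
  | insert a s ha ih =>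
    rw [Finset.sum_insert ha, Finset.union_insert]
    by_cases h : a ∈ C ∪ s
    · rw [Finset.insert_eq_of_mem h]
      linarith [hmono (Finset.subset_insert a C)]
    · linarith [hsub (Finset.subset_union_left : C ⊆ C ∪ s) a h]

/-- If `f` is monotone and submodular, `f K = f E` with `|K| = k ≥ 1`, and
`e*` maximizes the marginal gain over `C`, then adding `e*` decreases the
deficiency `f E - f C` by a factor of at least `1 - 1/k`:
`k * (f E - f (C + e*)) ≤ (k - 1) * (f E - f C)`. -/
theorem greedy_step_decreases_deficiency {E : Type*} [Fintype E] [DecidableEq E]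
    (f : Finset E → ℤ) (hmono : Monotone f) (hsub : Submodular f)
    (K : Finset E) (k : ℕ) (hk : 1 ≤ k) (hKcard : K.card = k)
    (hKopt : f K = f Finset.univ)
    (C : Finset E) (estar : E)
    (hstar : ∀ e : E, f (insert e C) - f C ≤ f (insert estar C) - f C) :
    (k : ℤ) * (f Finset.univ - f (insert estar C)) ≤
      ((k : ℤ) - 1) * (f Finset.univ - f C) := by
  have hunion : f (C ∪ K) = f Finset.univ :=
    le_antisymm (hmono (Finset.subset_univ _))
      (hKopt ▸ hmono (Finset.subset_union_right : K ⊆ C ∪ K))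
  have hsum : ∑ e ∈ K, (f (insert e C) - f C) ≤ (k : ℤ) * (f (insert estar C) - f C) := by
    simpa [hKcard] using Finset.sum_le_card_nsmul K _ _ fun e _ => hstar e
  linarith [hsub.union_sub_le_sum hmono C K]
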